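/- Let K ⊆ ℝⁿ be a symmetric convex set with vol(K) > 0, and let D = N(0,I_n)|K. Then Var_{x ∼ D}[‖x‖²] ≤ 4n. -/

import Mathlib

open MeasureTheory ProbabilityTheory Real

/-- The standard Gaussian measure `N(0, I_n)` on `ℝⁿ`. -/
noncomputable def stdGaussian (n : ℕ) : Measure (EuclideanSpace ℝ (Fin n)) :=
  volume.withDensity fun x =>
    ENNReal.ofReal ((2 * π) ^ (-(n : ℝ) / 2) * Real.exp (-‖x‖ ^ 2 / 2))

/-- The standard Gaussian measure conditioned on the set `K`. -/
noncomputable def truncGaussian (n : ℕ) (K : Set (EuclideanSpace ℝ (Fin n))) :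
    Measure (EuclideanSpace ℝ (Fin n)) :=
  (stdGaussian n K)⁻¹ • (stdGaussian n).restrict K

lemma bm_one {A B C : Set ℝ} (hA : MeasurableSet A) (hB : MeasurableSet B)
    (hAn : A.Nonempty) (hBn : B.Nonempty) (h : ∀ x ∈ A, ∀ y ∈ B, x + y ∈ C) :
    volume A + volume B ≤ volume C := by
  -- compact case
  have key : ∀ P Q : Set ℝ, P ⊆ A → Q ⊆ B → IsCompact P → IsCompact Q → P.Nonempty → Q.Nonempty →
      volume P + volume Q ≤ volume C := by
    intro P Q hPA hQB hP hQ hPn hQn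
    obtain ⟨a, haP, ha⟩ := hP.exists_isGreatest hPn
    obtain ⟨b, hbQ, hb⟩ := hQ.exists_isLeast hQn
    have h1 : volume ((fun x => x + (-b)) ⁻¹' P) = volume P := measure_preimage_add_right _ _ _
    have h2 : volume ((fun x => (-a) + x) ⁻¹' Q) = volume Q := measure_preimage_add _ _ _
    rw [← h1, ← h2]
    have hm : MeasurableSet ((fun x => (-a) + x) ⁻¹' Q) :=
      (measurable_const_add _) hQ.measurableSet
    rw [← measure_union₀ hm.nullMeasurableSet]
    · apply measure_mono
      rintro z (hz | hz)
      · have := h _ (hPA hz) b (hQB hbQ)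
        simpa using this
      · have := h a (hPA haP) _ (hQB hz)
        simpa using this
    · refine measure_mono_null (t := {a + b}) ?_ (by simp)
      rintro z ⟨hz1, hz2⟩
      have e1 := ha hz1
      have e2 := hb hz2
      simp only [Set.mem_singleton_iff]
      linarith
  obtain ⟨a0, ha0⟩ := hAn
  obtain ⟨b0, hb0⟩ := hBn
  rw [hA.measure_eq_iSup_isCompact, hB.measure_eq_iSup_isCompact]
  rw [iSup_congr fun P => iSup_and' (p := P ⊆ A) (q := IsCompact P) (s := fun _ _ => volume P),
    iSup_congr fun P => iSup_and' (p := P ⊆ B) (q := IsCompact P) (s := fun _ _ => volume P)]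
  refine ENNReal.biSup_add_biSup_le' ⟨∅, by simp⟩ ⟨∅, by simp⟩ ?_
  rintro P ⟨hPA, hP⟩ Q ⟨hQB, hQ⟩
  exact (add_le_add (measure_mono (Set.subset_insert a0 P))
    (measure_mono (Set.subset_insert b0 Q))).trans
    (key (insert a0 P) (insert b0 Q) (Set.insert_subset ha0 hPA) (Set.insert_subset hb0 hQB)
      (hP.insert a0) (hQ.insert b0) (Set.insert_nonempty _ _) (Set.insert_nonempty _ _))

lemma pl_norm {f g h : ℝ → ℝ} (hf : Measurable f) (hg : Measurable g) (hh : Measurable h)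
    (f0 : ∀ x, 0 ≤ f x) (g0 : ∀ x, 0 ≤ g x) (h0 : ∀ x, 0 ≤ h x)
    (f1 : ∀ x, f x ≤ 1) (g1 : ∀ x, g x ≤ 1)
    (fs : ∀ t < 1, ∃ x, t < f x) (gs : ∀ t < 1, ∃ x, t < g x)
    (H : ∀ x y, f x * g y ≤ h (x + y) ^ 2) :
    (∫⁻ x, ENNReal.ofReal (f x)) + (∫⁻ x, ENNReal.ofReal (g x)) ≤ ∫⁻ x, ENNReal.ofReal (h x) := by
  rw [lintegral_eq_lintegral_meas_lt _ (.of_forall f0) hf.aemeasurable,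
    lintegral_eq_lintegral_meas_lt _ (.of_forall g0) hg.aemeasurable,
    lintegral_eq_lintegral_meas_lt _ (.of_forall h0) hh.aemeasurable,
    ← lintegral_add_left]
  · refine setLIntegral_mono_ae' measurableSet_Ioi (.of_forall fun t ht => ?_)
    have ht : 0 < t := ht
    by_cases h1 : t < 1
    · refine bm_one (measurableSet_lt measurable_const hf) (measurableSet_lt measurable_const hg)
        (fs t h1) (gs t h1) ?_
      intro x hx y hy
      simp only [Set.mem_ofPred_eq] at *
      have := H x y
      by_contra hc
      push Not at hc
      nlinarith [h0 (x + y), mul_pos (sub_pos.2 hx) (sub_pos.2 hy)]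
    · have e1 : {a | t < f a} = ∅ := by
        ext x; simp; linarith [f1 x]
      have e2 : {a | t < g a} = ∅ := by
        ext x; simp; linarith [g1 x]
      simp [e1, e2]
  · exact Antitone.measurable (fun s t hst => measure_mono fun x hx => lt_of_le_of_lt hst hx)

open scoped ENNReal

lemma four_mul_le_sq (a b : ℝ≥0∞) : 4 * (a * b) ≤ (a + b) ^ 2 := by
  by_cases ha : a = ⊤
  · simp [ha]
  by_cases hb : b = ⊤
  · simp [hb]
  lift a to NNReal using ha
  lift b to NNReal using hb
  norm_cast
  rw [← NNReal.coe_le_coe]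
  push_cast
  nlinarith [sq_nonneg ((a : ℝ) - b)]

lemma pl_bdd {f g h : ℝ → ℝ≥0∞} (hf : Measurable f) (hg : Measurable g) (hh : Measurable h)
    (N : ℝ≥0∞) (hN : N ≠ ⊤) (fN : ∀ x, f x ≤ N) (gN : ∀ x, g x ≤ N)
    (H : ∀ x y, f x * g y ≤ h (x + y) ^ 2) :
    4 * ((∫⁻ x, f x) * (∫⁻ x, g x)) ≤ (∫⁻ x, h x) ^ 2 := by
  set A := ⨆ x, f x with hA
  set B := ⨆ x, g x with hB
  have fA : ∀ x, f x ≤ A := fun x => le_iSup f x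
  have gB : ∀ x, g x ≤ B := fun x => le_iSup g x
  have hAt : A ≠ ⊤ := ne_top_of_le_ne_top hN (iSup_le fN)
  have hBt : B ≠ ⊤ := ne_top_of_le_ne_top hN (iSup_le gN)
  by_cases hA0 : A = 0
  · have : ∀ x, f x = 0 := fun x => le_antisymm (hA0 ▸ fA x) bot_le
    simp [this]
  by_cases hB0 : B = 0
  · have : ∀ x, g x = 0 := fun x => le_antisymm (hB0 ▸ gB x) bot_le
    simp [this]
  set r : ℝ≥0∞ := (A * B) ^ (1 / 2 : ℝ) with hr
  have hr2 : r ^ 2 = A * B := by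
    rw [hr, ← ENNReal.rpow_natCast, ← ENNReal.rpow_mul]; norm_num
  have hABt : A * B ≠ ⊤ := ENNReal.mul_ne_top hAt hBt
  have hrt : r ≠ ⊤ := by
    rw [hr]; exact ENNReal.rpow_ne_top_of_nonneg (by norm_num) hABt
  have hr0 : r ≠ 0 := by
    intro h0
    rw [h0] at hr2
    simp [hA0, hB0] at hr2
  have div_le_one' : ∀ x, f x / A ≤ 1 := fun x => ENNReal.div_le_of_le_mul (by simpa using fA x)
  have div_le_one'' : ∀ x, g x / B ≤ 1 := fun x => ENNReal.div_le_of_le_mul (by simpa using gB x)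
  have ft : ∀ x, f x / A ≠ ⊤ := fun x => ne_top_of_le_ne_top (by simp) (div_le_one' x)
  have gt : ∀ x, g x / B ≠ ⊤ := fun x => ne_top_of_le_ne_top (by simp) (div_le_one'' x)
  have ht : ∀ x, min (h x / r) 1 ≠ ⊤ := fun x => ne_top_of_le_ne_top (by simp) (min_le_right _ _)
  have sup : ∀ (F : ℝ → ℝ≥0∞) (C : ℝ≥0∞), C = ⨆ x, F x → C ≠ 0 → C ≠ ⊤ → (∀ x, F x / C ≠ ⊤) →
      ∀ t < (1 : ℝ), ∃ x, t < (F x / C).toReal := by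
    intro F C hC hC0 hCt hF t ht1
    by_cases ht0 : t < 0
    · exact ⟨0, ht0.trans_le ENNReal.toReal_nonneg⟩
    push Not at ht0
    have : ENNReal.ofReal t * C < ⨆ x, F x := by
      rw [← hC]
      calc ENNReal.ofReal t * C < 1 * C := by
            apply ENNReal.mul_lt_mul_left hC0 hCt
            simpa using ht1
        _ = C := one_mul _
    obtain ⟨x, hx⟩ := lt_iSup_iff.1 this
    refine ⟨x, ?_⟩
    rw [← ENNReal.ofReal_lt_iff_lt_toReal ht0 (hF x)]
    rwa [ENNReal.lt_div_iff_mul_lt (Or.inl hC0) (Or.inl hCt)]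
  have key := pl_norm (f := fun x => (f x / A).toReal) (g := fun x => (g x / B).toReal)
    (h := fun x => (min (h x / r) 1).toReal) (by fun_prop) (by fun_prop) (by fun_prop)
    (fun _ => ENNReal.toReal_nonneg) (fun _ => ENNReal.toReal_nonneg)
    (fun _ => ENNReal.toReal_nonneg)
    (fun x => by simpa using ENNReal.toReal_mono (by simp) (div_le_one' x))
    (fun x => by simpa using ENNReal.toReal_mono (by simp) (div_le_one'' x))
    (sup f A hA hA0 hAt ft) (sup g B hB hB0 hBt gt) (by
      intro x y
      rw [← ENNReal.toReal_mul, ← ENNReal.toReal_pow]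
      refine ENNReal.toReal_mono (ENNReal.pow_ne_top (ht _)) ?_
      rcases min_choice (h (x + y) / r) 1 with h1 | h1
      · rw [h1, div_eq_mul_inv, div_eq_mul_inv, div_eq_mul_inv, mul_pow, ← ENNReal.inv_pow, hr2,
          ENNReal.mul_inv (Or.inl hA0) (Or.inl hAt)]
        calc _ = f x * g y * (A⁻¹ * B⁻¹) := by ring
          _ ≤ _ := by gcongr; exact H x y
      · rw [h1]
        simpa using mul_le_mul' (div_le_one' x) (div_le_one'' y))
  simp only [ENNReal.ofReal_toReal (ft _), ENNReal.ofReal_toReal (gt _),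
    ENNReal.ofReal_toReal (ht _)] at key
  have key2 := key.trans (lintegral_mono fun x => min_le_left _ _)
  simp only [div_eq_mul_inv] at key2
  rw [lintegral_mul_const _ hf, lintegral_mul_const _ hg, lintegral_mul_const _ hh] at key2
  have key3 := (four_mul_le_sq _ _).trans (pow_le_pow_left' key2 2)
  rw [mul_pow, ← ENNReal.inv_pow, hr2] at key3
  calc 4 * ((∫⁻ x, f x) * (∫⁻ x, g x))
      = 4 * (((∫⁻ x, f x) * A⁻¹) * ((∫⁻ x, g x) * B⁻¹)) * (A * B) := by
        have e1 := ENNReal.inv_mul_cancel hA0 hAt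
        have e2 := ENNReal.inv_mul_cancel hB0 hBt
        calc _ = 4 * ((∫⁻ x, f x) * (∫⁻ x, g x)) * ((A⁻¹ * A) * (B⁻¹ * B)) := by rw [e1, e2]; simp
          _ = _ := by ring
    _ ≤ (∫⁻ x, h x) ^ 2 * (A * B)⁻¹ * (A * B) := by gcongr
    _ = _ := by
        rw [mul_assoc, ENNReal.inv_mul_cancel (mul_ne_zero hA0 hB0) hABt, mul_one]

lemma pl_one {f g h : ℝ → ℝ≥0∞} (hf : Measurable f) (hg : Measurable g) (hh : Measurable h)
    (H : ∀ x y, f x * g y ≤ h (x + y) ^ 2) :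
    4 * ((∫⁻ x, f x) * (∫⁻ x, g x)) ≤ (∫⁻ x, h x) ^ 2 := by
  have tr : ∀ F : ℝ → ℝ≥0∞, Measurable F → Monotone (fun N : ℕ => ∫⁻ x, min (F x) N) ∧
      ∫⁻ x, F x = ⨆ N : ℕ, ∫⁻ x, min (F x) N := by
    intro F hF
    have mono : Monotone (fun (N : ℕ) x => min (F x) (N : ℝ≥0∞)) := by
      intro a b hab x
      exact min_le_min le_rfl (by exact_mod_cast hab)
    refine ⟨fun a b hab => lintegral_mono (mono hab), ?_⟩
    rw [← lintegral_iSup (fun N => by fun_prop) mono]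
    congr with x
    rw [← inf_iSup_eq, ENNReal.iSup_natCast, inf_top_eq]
  rw [(tr f hf).2, (tr g hg).2]
  simp only [ENNReal.iSup_mul, ENNReal.mul_iSup]
  refine iSup_le fun M => iSup_le fun N => ?_
  have := pl_bdd (f := fun x => min (f x) N) (g := fun x => min (g x) M) (by fun_prop)
    (by fun_prop) hh (max N M) (by simp) (fun x => (min_le_right _ _).trans (le_max_left _ _))
    (fun x => (min_le_right _ _).trans (le_max_right _ _)) fun x y =>
    (mul_le_mul' (min_le_left _ _) (min_le_left _ _)).trans (H x y)
  exact this

lemma pl_pi (n : ℕ) {f g h : (Fin n → ℝ) → ℝ≥0∞} (hf : Measurable f) (hg : Measurable g)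
    (hh : Measurable h) (H : ∀ x y, f x * g y ≤ h (x + y) ^ 2) :
    4 ^ n * ((∫⁻ x, f x) * (∫⁻ x, g x)) ≤ (∫⁻ x, h x) ^ 2 := by
  induction n with
  | zero =>
    rw [Measure.volume_pi_eq_dirac 0]
    simpa using H 0 0
  | succ n ih =>
    let e := (MeasurableEquiv.piFinSuccAbove (fun _ : Fin (n + 1) => ℝ) 0).symm
    have he : MeasurePreserving e := (volume_preserving_piFinSuccAbove _ 0).symm _
    have eadd : ∀ x y, e (x + y) = e x + e y := by
      intro x y
      ext i
      refine Fin.cases ?_ (fun j => ?_) i <;> simp [e, MeasurableEquiv.piFinSuccAbove]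
    have fub : ∀ F : (Fin (n + 1) → ℝ) → ℝ≥0∞, Measurable F →
        ∫⁻ x, F x = ∫⁻ a, ∫⁻ b, F (e (a, b)) := by
      intro F hF
      rw [← he.lintegral_comp hF, Measure.volume_eq_prod, lintegral_prod]
      exact (hF.comp e.measurable).aemeasurable
    have mm : ∀ F : (Fin (n + 1) → ℝ) → ℝ≥0∞, Measurable F →
        Measurable fun a => ∫⁻ b, F (e (a, b)) := fun F hF =>
      Measurable.lintegral_prod_right' (f := fun p => F (e p)) (hF.comp e.measurable)
    rw [fub f hf, fub g hg, fub h hh]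
    have := pl_one (f := fun a => 2 ^ n * ∫⁻ b, f (e (a, b))) (g := fun a => 2 ^ n * ∫⁻ b, g (e (a, b)))
      (h := fun a => ∫⁻ b, h (e (a, b))) ((mm f hf).const_mul _) ((mm g hg).const_mul _) (mm h hh) (by
        intro x y
        have := ih (f := fun b => f (e (x, b))) (g := fun b => g (e (y, b)))
          (h := fun b => h (e (x + y, b))) (by fun_prop) (by fun_prop) (by fun_prop) (by
            intro a b
            have := H (e (x, a)) (e (y, b))
            rwa [← eadd] at this)
        refine le_trans (le_of_eq ?_) this
        rw [show (4 : ℝ≥0∞) = 2 * 2 by norm_num, mul_pow]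
        ring)
    refine le_trans (le_of_eq ?_) this
    rw [lintegral_const_mul _ (mm f hf), lintegral_const_mul _ (mm g hg)]
    rw [show (4 : ℝ≥0∞) = 2 * 2 by norm_num, mul_pow]
    ring

lemma pl_euc (n : ℕ) {f g h : EuclideanSpace ℝ (Fin n) → ℝ≥0∞} (hf : Measurable f)
    (hg : Measurable g) (hh : Measurable h) (H : ∀ x y, f x * g y ≤ h (x + y) ^ 2) :
    4 ^ n * ((∫⁻ x, f x) * (∫⁻ x, g x)) ≤ (∫⁻ x, h x) ^ 2 := by
  have he := PiLp.volume_preserving_toLp (Fin n)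
  rw [← he.lintegral_comp hf, ← he.lintegral_comp hg, ← he.lintegral_comp hh]
  exact pl_pi n (hf.comp he.measurable) (hg.comp he.measurable) (hh.comp he.measurable)
    fun x y => H _ _

lemma lintegral_scale (n : ℕ) {F : EuclideanSpace ℝ (Fin n) → ℝ≥0∞} (hF : Measurable F)
    {s : ℝ} (hs : 0 < s) :
    ∫⁻ x, F (s⁻¹ • x) = ENNReal.ofReal (s ^ n) * ∫⁻ x, F x := by
  have h1 := Measure.map_addHaar_smul (volume : Measure (EuclideanSpace ℝ (Fin n)))
    (r := s⁻¹) (by positivity)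
  rw [← lintegral_map (g := fun x => s⁻¹ • x) hF (measurable_const_smul _), h1,
    lintegral_smul_measure, smul_eq_mul]
  simp [abs_of_pos hs]

/-- The unnormalised Gaussian integral over `K`, at inverse temperature `s`. -/
noncomputable def LK (n : ℕ) (K : Set (EuclideanSpace ℝ (Fin n))) (s : ℝ) : ℝ≥0∞ :=
  ∫⁻ x in K, ENNReal.ofReal (Real.exp (-s * (‖x‖ ^ 2 / 2)))

lemma LK_ineq (n : ℕ) (K : Set (EuclideanSpace ℝ (Fin n)))
    (hconv : Convex ℝ K) (hmeas : MeasurableSet K) {ε : ℝ} (h0 : 0 < ε) (h1 : ε < 1) :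
    ENNReal.ofReal ((1 - ε ^ 2) ^ n) * (LK n K (1 + ε) * LK n K (1 - ε)) ≤ LK n K 1 ^ 2 := by
  let G : ℝ → EuclideanSpace ℝ (Fin n) → ℝ≥0∞ := fun s =>
    K.indicator fun x => ENNReal.ofReal (Real.exp (-s * (‖x‖ ^ 2 / 2)))
  have hG : ∀ s, Measurable (G s) := fun s => Measurable.indicator (by fun_prop) hmeas
  have hL : ∀ s, LK n K s = ∫⁻ x, G s x := fun s => (lintegral_indicator hmeas _).symm
  have key := pl_euc n (f := fun x => G (1 + ε) ((1 + ε)⁻¹ • x))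
    (g := fun x => G (1 - ε) ((1 - ε)⁻¹ • x)) (h := fun x => G 1 ((2 : ℝ)⁻¹ • x))
    ((hG _).comp (measurable_const_smul _)) ((hG _).comp (measurable_const_smul _))
    ((hG _).comp (measurable_const_smul _)) (by
      intro x y
      have hp : 0 < 1 + ε := by linarith
      have hm : 0 < 1 - ε := by linarith
      obtain ⟨a, rfl⟩ : ∃ a, x = (1 + ε) • a := ⟨(1 + ε)⁻¹ • x, by rw [smul_inv_smul₀ hp.ne']⟩
      obtain ⟨b, rfl⟩ : ∃ a, y = (1 - ε) • a := ⟨(1 - ε)⁻¹ • y, by rw [smul_inv_smul₀ hm.ne']⟩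
      simp only [inv_smul_smul₀ hp.ne', inv_smul_smul₀ hm.ne']
      by_cases ha : a ∈ K
      swap
      · simp [G, ha]
      by_cases hb : b ∈ K
      swap
      · simp [G, hb]
      have hab : (2 : ℝ)⁻¹ • ((1 + ε) • a + (1 - ε) • b) = ((1 + ε) / 2) • a + ((1 - ε) / 2) • b := by
        rw [smul_add, smul_smul, smul_smul]; congr 2 <;> ring
      have hc : ((1 + ε) / 2) • a + ((1 - ε) / 2) • b ∈ K :=
        hconv ha hb (by positivity) (by positivity) (by ring)
      rw [hab]
      simp only [G, Set.indicator_of_mem ha, Set.indicator_of_mem hb, Set.indicator_of_mem hc]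
      rw [← ENNReal.ofReal_mul (by positivity), ← ENNReal.ofReal_pow (by positivity),
        ← Real.exp_add, ← Real.exp_nat_mul]
      apply ENNReal.ofReal_le_ofReal
      apply Real.exp_le_exp.2
      have e1 : ‖((1 + ε) / 2) • a + ((1 - ε) / 2) • b‖ ≤ (1 + ε) / 2 * ‖a‖ + (1 - ε) / 2 * ‖b‖ := by
        refine (norm_add_le _ _).trans (le_of_eq ?_)
        rw [norm_smul, norm_smul, Real.norm_of_nonneg (by positivity),
          Real.norm_of_nonneg (by positivity)]
      have e2 := pow_le_pow_left₀ (norm_nonneg _) e1 2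
      push_cast
      nlinarith [mul_nonneg (mul_nonneg hp.le hm.le) (sq_nonneg (‖a‖ - ‖b‖))])
  rw [lintegral_scale n (hG _) (by linarith), lintegral_scale n (hG _) (by linarith),
    lintegral_scale n (hG _) (by norm_num), ← hL, ← hL, ← hL] at key
  have e4 : ENNReal.ofReal ((2 : ℝ) ^ n) ^ 2 = 4 ^ n := by
    rw [ENNReal.ofReal_pow (by norm_num), ← pow_mul, mul_comm, pow_mul]
    norm_num
  rw [mul_pow, e4] at key
  have := (ENNReal.mul_le_mul_iff_right (by simp) (by finiteness)).1 key
  refine le_trans (le_of_eq ?_) this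
  rw [show 1 - ε ^ 2 = (1 + ε) * (1 - ε) by ring, mul_pow, ENNReal.ofReal_mul (by positivity)]
  ring

lemma LK_lt_top (n : ℕ) (K : Set (EuclideanSpace ℝ (Fin n))) {s : ℝ} (hs : 0 < s) :
    LK n K s < ⊤ := by
  refine lt_of_le_of_lt (setLIntegral_le_lintegral _ _) ?_
  have := (GaussianFourier.integrable_cexp_neg_mul_sq_norm_add (V := EuclideanSpace ℝ (Fin n))
    (b := ((s / 2 : ℝ) : ℂ)) (by simpa using hs) 0 0).norm.lintegral_lt_top
  convert this using 5 with x
  rw [Complex.norm_exp]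
  congr 1
  simp [← Complex.ofReal_pow]
  norm_cast
  ring

lemma gauss_eq (n : ℕ) (K : Set (EuclideanSpace ℝ (Fin n))) (hmeas : MeasurableSet K) (t : ℝ) :
    ∫⁻ x in K, ENNReal.ofReal (Real.exp (t * (‖x‖ ^ 2 / 2))) ∂(stdGaussian n) =
      ENNReal.ofReal ((2 * π) ^ (-(n : ℝ) / 2)) * LK n K (1 - t) := by
  rw [_root_.stdGaussian, restrict_withDensity hmeas, lintegral_withDensity_eq_lintegral_mul _ (by fun_prop)
    (by fun_prop), LK, ← lintegral_const_mul _ (by fun_prop)]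
  congr with x
  simp only [Pi.mul_apply]
  rw [← ENNReal.ofReal_mul (by positivity), ← ENNReal.ofReal_mul (by positivity), mul_assoc,
    ← Real.exp_add]
  ring_nf

lemma gauss_K (n : ℕ) (K : Set (EuclideanSpace ℝ (Fin n))) (hmeas : MeasurableSet K) :
    stdGaussian n K = ENNReal.ofReal ((2 * π) ^ (-(n : ℝ) / 2)) * LK n K 1 := by
  simpa using gauss_eq n K hmeas 0

lemma one_add_le_cosh (x : ℝ) : 1 + x ^ 2 / 2 ≤ Real.cosh x := by
  have h1 : Real.cosh x = 1 + 2 * Real.sinh (x / 2) ^ 2 := by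
    have := Real.cosh_two_mul (x / 2)
    rw [mul_div_cancel₀ _ (by norm_num)] at this
    rw [this, Real.cosh_sq]; ring
  have h2 : (x / 2) ^ 2 ≤ Real.sinh (x / 2) ^ 2 := by
    rw [sq_le_sq]
    rcases le_total 0 (x / 2) with h | h
    · rw [abs_of_nonneg h, abs_of_nonneg (Real.sinh_nonneg_iff.2 h)]
      exact Real.self_le_sinh_iff.2 h
    · rw [abs_of_nonpos h, abs_of_nonpos (Real.sinh_nonpos_iff.2 h)]
      exact neg_le_neg (Real.sinh_le_self_iff.2 h)
  rw [h1]; nlinarith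

lemma var_le {Ω : Type*} [MeasurableSpace Ω] (D : Measure Ω) [IsProbabilityMeasure D] (X : Ω → ℝ)
    (n : ℕ) (hint : ∀ t, |t| < 1 → Integrable (fun x => Real.exp (t * X x)) D)
    (H : ∀ t, 0 < t → t < 1 → (1 - t ^ 2) ^ n * (mgf X D t * mgf X D (-t)) ≤ 1) :
    variance X D ≤ n := by
  have hmem : 0 ∈ interior (integrableExpSet X D) := by
    refine mem_interior.2 ⟨Set.Ioo (-1) 1, fun t ht => hint t (abs_lt.2 ht), isOpen_Ioo, by simp⟩
  have hX2 : MemLp X 2 D := memLp_of_mem_interior_integrableExpSet hmem 2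
  have hX : Integrable X D := hX2.integrable (by norm_num)
  have hXs : Integrable (fun x => X x ^ 2) D := hX2.integrable_sq
  set V := variance X D with hV
  set m := ∫ x, X x ∂D with hm
  have hVm : ∫ x, X x ^ 2 ∂D = V + m ^ 2 := by
    rw [hV, variance_eq_sub hX2]; simp [hm]
  have hV0 : 0 ≤ V := variance_nonneg _ _
  -- the lower bound
  have low : ∀ t, 0 < t → t < 1 → 1 + t ^ 2 * V ≤ mgf X D t * mgf X D (-t) := by
    intro t ht0 ht1
    have i1 := hint t (by rw [abs_of_pos ht0]; exact ht1)
    have i2 := hint (-t) (by rw [abs_neg, abs_of_pos ht0]; exact ht1)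
    have inner : ∀ c : ℝ, 1 + t ^ 2 / 2 * (V + m ^ 2 - 2 * c * m + c ^ 2) ≤
        (mgf X D t * Real.exp (-t * c) + mgf X D (-t) * Real.exp (t * c)) / 2 := by
      intro c
      have e : ∫ x, (1 + t ^ 2 / 2 * (X x ^ 2 - 2 * c * X x + c ^ 2)) ∂D =
          1 + t ^ 2 / 2 * (V + m ^ 2 - 2 * c * m + c ^ 2) := by
        rw [integral_add (by fun_prop) (by fun_prop), integral_const_mul,
          integral_add (by fun_prop) (by fun_prop), integral_sub (by fun_prop) (by fun_prop),
          integral_const_mul, hVm]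
        simp [hm]
      have e' : ∫ x, (Real.exp (t * X x) * Real.exp (-t * c)
          + Real.exp (-t * X x) * Real.exp (t * c)) / 2 ∂D =
          (mgf X D t * Real.exp (-t * c) + mgf X D (-t) * Real.exp (t * c)) / 2 := by
        rw [integral_div, integral_add (i1.mul_const _) (i2.mul_const _), integral_mul_const,
          integral_mul_const]
        rfl
      rw [← e, ← e']
      refine integral_mono (by fun_prop) (((i1.mul_const _).add (i2.mul_const _)).div_const _) ?_
      intro x
      have := one_add_le_cosh (t * (X x - c))
      rw [Real.cosh_eq] at this
      simp only [← Real.exp_add]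
      calc _ = 1 + (t * (X x - c)) ^ 2 / 2 := by ring
        _ ≤ _ := this
        _ = _ := by ring_nf
    have e : ∫ y, (1 + t ^ 2 / 2 * (V + m ^ 2 - 2 * m * X y + X y ^ 2)) ∂D =
          1 + t ^ 2 * V := by
        rw [integral_add (by fun_prop) (by fun_prop), integral_const_mul,
          integral_add (by fun_prop) (by fun_prop), integral_sub (by fun_prop) (by fun_prop),
          integral_const_mul, hVm]
        simp [← hm]
        ring
    have e' : ∫ y, (mgf X D t * Real.exp (-t * X y) + mgf X D (-t) * Real.exp (t * X y)) / 2 ∂D =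
          mgf X D t * mgf X D (-t) := by
        rw [integral_div, integral_add (i2.const_mul _) (i1.const_mul _), integral_const_mul,
          integral_const_mul]
        change (mgf X D t * mgf X D (-t) + mgf X D (-t) * mgf X D t) / 2 = _
        ring
    rw [← e, ← e']
    refine integral_mono (by fun_prop) (((i2.const_mul _).add (i1.const_mul _)).div_const _) ?_
    intro y
    refine le_trans (le_of_eq ?_) (inner (X y))
    ring
  -- conclude
  have fin : ∀ u : ℝ, 0 < u → u < 1 → V ≤ n + u * (n * V) := by
    intro u hu0 hu1
    have ht0 : 0 < √u := Real.sqrt_pos.2 hu0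
    have ht1 : √u < 1 := by rw [Real.sqrt_lt' one_pos]; simpa using hu1
    have a1 := low _ ht0 ht1
    have a2 := H _ ht0 ht1
    rw [Real.sq_sqrt hu0.le] at a1 a2
    have a3 : 1 + (n : ℝ) * (-u) ≤ (1 + (-u)) ^ n := one_add_mul_le_pow (by linarith) n
    have a4 : (1 - u) ^ n * (1 + u * V) ≤ 1 :=
      (mul_le_mul_of_nonneg_left a1 (pow_nonneg (by linarith) n)).trans a2
    rw [← sub_eq_add_neg] at a3
    have a5 : (1 + (n : ℝ) * (-u)) * (1 + u * V) ≤ 1 :=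
      (mul_le_mul_of_nonneg_right a3 (by positivity)).trans a4
    have a6 : u * V ≤ u * (n + u * (n * V)) := by nlinarith
    exact le_of_mul_le_mul_left a6 hu0
  have lim : Filter.Tendsto (fun u : ℝ => (n : ℝ) + u * (n * V)) (nhdsWithin 0 (Set.Ioi 0))
      (nhds n) := by
    have : Continuous (fun u : ℝ => (n : ℝ) + u * (n * V)) := by fun_prop
    simpa using (this.tendsto 0).mono_left nhdsWithin_le_nhds
  refine ge_of_tendsto lim ?_
  filter_upwards [Ioo_mem_nhdsGT (one_pos : (0 : ℝ) < 1)] with u hu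
  exact fin u hu.1 hu.2

/-- for a symmetric convex set `K ⊆ ℝⁿ` of positive Gaussian volume, the
variance of `x ↦ ‖x‖²` under `N(0,I_n)|K` is at most `4n`. -/
theorem variance_sq_norm_truncated_gaussian_symm_le
    (n : ℕ) (K : Set (EuclideanSpace ℝ (Fin n)))
    (hconv : Convex ℝ K) (hsymm : ∀ x ∈ K, -x ∈ K) (hmeas : MeasurableSet K)
    (hpos : 0 < (stdGaussian n K).toReal) :
    variance (fun x => ‖x‖ ^ 2) (truncGaussian n K) ≤ 4 * n := by
  obtain ⟨hg0, hgt⟩ := ENNReal.toReal_pos_iff.1 hpos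
  have hc : 0 < (2 * π : ℝ) ^ (-(n : ℝ) / 2) := by positivity
  have hL0 : 0 < LK n K 1 := by
    rw [gauss_K n K hmeas] at hg0
    exact pos_iff_ne_zero.2 (right_ne_zero_of_mul hg0.ne')
  have hL0' : 0 < (LK n K 1).toReal := ENNReal.toReal_pos hL0.ne' (LK_lt_top n K one_pos).ne
  have : IsProbabilityMeasure (truncGaussian n K) := by
    constructor
    simp [truncGaussian, ENNReal.inv_mul_cancel hg0.ne' hgt.ne]
  set X : EuclideanSpace ℝ (Fin n) → ℝ := fun x => ‖x‖ ^ 2 / 2 with hXdef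
  have hl : ∀ t, ∫⁻ x, ENNReal.ofReal (Real.exp (t * X x)) ∂(truncGaussian n K) =
      (LK n K 1)⁻¹ * LK n K (1 - t) := by
    intro t
    rw [truncGaussian, lintegral_smul_measure, gauss_eq n K hmeas, gauss_K n K hmeas, smul_eq_mul,
      ENNReal.mul_inv (by simp [hc]) (by simp)]
    calc _ = ((ENNReal.ofReal ((2 * π) ^ (-(n : ℝ) / 2)))⁻¹ *
          ENNReal.ofReal ((2 * π) ^ (-(n : ℝ) / 2))) * ((LK n K 1)⁻¹ * LK n K (1 - t)) := by ring
      _ = _ := by rw [ENNReal.inv_mul_cancel (by simpa using hc) (by simp), one_mul]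
  have hint : ∀ t, |t| < 1 → Integrable (fun x => Real.exp (t * X x)) (truncGaussian n K) := by
    intro t ht
    refine ⟨by fun_prop, ?_⟩
    rw [hasFiniteIntegral_iff_ofReal (.of_forall fun x => (Real.exp_pos _).le), hl]
    exact ENNReal.mul_lt_top (by simpa using hL0) (LK_lt_top n K (by linarith [(abs_lt.1 ht).2]))
  have hmgf : ∀ t, mgf X (truncGaussian n K) t = (LK n K (1 - t)).toReal / (LK n K 1).toReal := by
    intro t
    rw [mgf, integral_eq_lintegral_of_nonneg_ae (.of_forall fun x => (Real.exp_pos _).le)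
      (by fun_prop), hl, ENNReal.toReal_mul, ENNReal.toReal_inv]
    ring
  have hv := var_le (truncGaussian n K) X n hint (by
    intro t ht0 ht1
    have := ENNReal.toReal_mono (ENNReal.pow_ne_top (LK_lt_top n K one_pos).ne)
      (LK_ineq n K hconv hmeas ht0 ht1)
    rw [ENNReal.toReal_mul, ENNReal.toReal_mul, ENNReal.toReal_pow,
      ENNReal.toReal_ofReal (pow_nonneg (by nlinarith) n)] at this
    rw [hmgf, hmgf, sub_neg_eq_add, div_mul_div_comm, ← mul_div_assoc, div_le_one (by positivity)]
    nlinarith)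
  have e : (fun x : EuclideanSpace ℝ (Fin n) => ‖x‖ ^ 2) = fun x => 2 * X x := by
    ext x; simp only [hXdef]; ring
  rw [e, variance_const_mul]
  linarith
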